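/- arXiv:2408.03919 — 2 statements merged into one kernel-verified Lean document; each statement's English description precedes it below -/
import Mathlib

section
/- There exists an absolute constant C ≥ 1 such that the following holds. Let κ > 0, M = C·κ⁻¹, let G ⊂ 𝕋 be measurable with ℋ¹(G) > 0, and let E ⊂ ℝ² be ℋ¹-measurable with ℋ¹(E) < ∞ and ℋ¹(π_θ(E)) > κ·ℋ¹(E) for all θ ∈ G. Set μ = ℋ¹|_E and, for x ∈ E, G(x) = {θ ∈ G : μ_θ(x) ≤ M}. Then the set E' = {x ∈ E : ℋ¹(G(x)) ≥ (κ/4)·ℋ¹(G)} satisfies ℋ¹(E') ≥ (κ/4)·ℋ¹(E). -/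
open MeasureTheory Metric Set
open scoped ENNReal NNReal

noncomputable section

abbrev R2 := EuclideanSpace ℝ (Fin 2)

/-- The unit vector in direction `2πθ`. -/
def dir (θ : ℝ) : R2 :=
  (EuclideanSpace.equiv (Fin 2) ℝ).symm ![Real.cos (2 * Real.pi * θ), Real.sin (2 * Real.pi * θ)]

/-- Orthogonal projection `π_θ`. -/
def proj (θ : ℝ) (x : R2) : ℝ :=
  x 0 * Real.cos (2 * Real.pi * θ) + x 1 * Real.sin (2 * Real.pi * θ)

/-- `π_θ^⊥ = π_{θ+1/4}`. -/
def projPerp (θ : ℝ) (x : R2) : ℝ := proj (θ + 1/4) x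

/-- Favard length. -/
def Fav (E : Set R2) : ℝ≥0∞ := ∫⁻ θ in Set.Icc (0:ℝ) 1, μH[1] (proj θ '' E)

/-- Ahlfors regularity with constant `A`. -/
def AhlforsRegular (A : ℝ) (E : Set R2) : Prop :=
  IsClosed E ∧ ∀ x ∈ E, ∀ r : ℝ, 0 < r → ENNReal.ofReal r < EMetric.diam E →
    ENNReal.ofReal (A⁻¹ * r) ≤ μH[1] (E ∩ ball x r) ∧
      μH[1] (E ∩ ball x r) ≤ ENNReal.ofReal (A * r)

/-- A Lipschitz graph with constant `L`: rotated graph of an `L`-Lipschitz function. -/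
def IsLipschitzGraph (L : ℝ) (Γ : Set R2) : Prop :=
  ∃ (R : R2 ≃ₗᵢ[ℝ] R2) (f : ℝ → ℝ), LipschitzWith (Real.toNNReal L) f ∧
    Γ = R '' {x : R2 | x 1 = f (x 0)}

/-- The (untruncated) cone `X(x,G)`. -/
def cone (x : R2) (G : Set ℝ) : Set R2 := ⋃ θ ∈ G, {y | ∃ t : ℝ, y = x + t • dir θ}

/-- The truncated cone `X(x,G,r)`. -/
def coneT (x : R2) (G : Set ℝ) (r : ℝ) : Set R2 := cone x G ∩ ball x r

/-- The doubly truncated cone `X(x,G,r,R)`. -/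
def coneA (x : R2) (G : Set ℝ) (r R : ℝ) : Set R2 := coneT x G R \ ball x r

/-- Hardy–Littlewood maximal function of a measure on `ℝ`. -/
def maximalFn (ν : Measure ℝ) (t : ℝ) : ℝ≥0∞ :=
  ⨆ (r : ℝ) (_ : 0 < r), ν (Set.Ioo (t - r) (t + r)) / ENNReal.ofReal (2 * r)

/-- `μ_θ(x) = M(π_θ μ)(π_θ x)`. -/
def projMax (μ : Measure R2) (θ : ℝ) (x : R2) : ℝ≥0∞ :=
  maximalFn (μ.map (proj θ)) (proj θ x)

/-- `μ_θ^⊥(x) = M(π_θ^⊥ μ)(π_θ^⊥ x)`. -/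
def projMaxPerp (μ : Measure R2) (θ : ℝ) (x : R2) : ℝ≥0∞ :=
  maximalFn (μ.map (projPerp θ)) (projPerp θ x)

/-- The interval with center `c` and length `ℓ`. -/
def itv (c ℓ : ℝ) : Set ℝ := Set.Icc (c - ℓ/2) (c + ℓ/2)

/-- The metric `d_I` associated to the interval with center `c` and length `ℓ`. -/
def dmet (c ℓ : ℝ) (x y : R2) : ℝ :=
  Real.sqrt ((ℓ^2)⁻¹ * (projPerp c x - projPerp c y)^2 + (proj c x - proj c y)^2)

/-- The open `d_I`-ball `B_I(x,r)`. -/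
def bmet (c ℓ : ℝ) (x : R2) (r : ℝ) : Set R2 := {y | dmet c ℓ x y < r}

/-- Triadic intervals of `[0,1)`. -/
def IsTriadic (I : Set ℝ) : Prop :=
  ∃ (j k : ℕ), k < 3^j ∧ I = Set.Ico ((k : ℝ)/3^j) ((k+1 : ℝ)/3^j)

/-- 1-dimensional Hausdorff content. -/
def hContent {X : Type*} [EMetricSpace X] (s : Set X) : ℝ≥0∞ :=
  ⨅ (t : ℕ → Set X) (_ : s ⊆ ⋃ n, t n), ∑' n, EMetric.diam (t n)

/-- `E` is a finite union of parallel segments. -/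
def FinUnionParallelSegments (E : Set R2) : Prop :=
  ∃ (n : ℕ) (d : R2) (p q : Fin n → R2), d ≠ 0 ∧
    (∀ i, ∃ t : ℝ, q i - p i = t • d) ∧ E = ⋃ i, segment ℝ (p i) (q i)


theorem exists_radius_of_lt_maximalFn {ν : Measure ℝ} {t : ℝ} {c : ℝ≥0∞}
    (h : c < maximalFn ν t) :
    ∃ r : ℝ, 0 < r ∧ c * ENNReal.ofReal (2 * r) < ν (Ioo (t - r) (t + r)) := by
  simp only [maximalFn, lt_iSup_iff] at h
  obtain ⟨r, hr, h⟩ := h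
  exact ⟨r, hr, (ENNReal.lt_div_iff_mul_lt (Or.inl (by simpa using hr))
    (Or.inl ENNReal.ofReal_ne_top)).1 h⟩

/-- Weak type (1,1) inequality for the Hardy–Littlewood maximal function. -/
theorem mul_volume_lt_maximalFn_le (ν : Measure ℝ) [IsFiniteMeasure ν] {a : ℝ} (ha : 0 < a) :
    ENNReal.ofReal a * volume {t | ENNReal.ofReal a < maximalFn ν t} ≤ 5 * ν univ := by
  set B := {t | ENNReal.ofReal a < maximalFn ν t}
  have hr : ∀ t : ℝ, ∃ r : ℝ, t ∈ B →
      0 < r ∧ ENNReal.ofReal a * ENNReal.ofReal (2 * r) < ν (Ioo (t - r) (t + r)) := fun t ↦ by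
    by_cases ht : t ∈ B
    · exact (exists_radius_of_lt_maximalFn ht).imp fun r h _ ↦ h
    · exact ⟨0, fun h ↦ absurd h ht⟩
  choose r hr using hr
  have hball : ∀ t ∈ B,
      ENNReal.ofReal a * ENNReal.ofReal (2 * r t) ≤ ν (closedBall t (r t)) := fun t ht ↦ by
    rw [Real.closedBall_eq_Icc]
    exact (hr t ht).2.le.trans (measure_mono Ioo_subset_Icc_self)
  have hbound : ∀ t ∈ B, r t ≤ (ν univ).toReal / a := fun t ht ↦ by
    have h := (hball t ht).trans (measure_mono (subset_univ _))
    rw [← ENNReal.ofReal_mul ha.le] at h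
    have h' := (ENNReal.ofReal_le_iff_le_toReal (measure_ne_top ν univ)).1 h
    rw [le_div_iff₀ ha]
    nlinarith [mul_pos ha (hr t ht).1]
  obtain ⟨u, huB, hdisj, hcov⟩ :=
    Vitali.exists_disjoint_subfamily_covering_enlargement_closedBall B id r _ hbound 5 (by norm_num)
  have hu : u.Countable := hdisj.countable_of_nonempty_interior fun t ht ↦
    (nonempty_ball.2 (hr t (huB ht)).1).mono ball_subset_interior_closedBall
  have hsub : B ⊆ ⋃ t ∈ u, closedBall t (5 * r t) := fun t ht ↦ by
    obtain ⟨b, hb, h⟩ := hcov t ht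
    exact mem_biUnion hb (h (mem_closedBall_self (hr t ht).1.le))
  calc ENNReal.ofReal a * volume B
      ≤ ENNReal.ofReal a * ∑' t : u, volume (closedBall (t : ℝ) (5 * r t)) := by
        gcongr
        exact (measure_mono hsub).trans (measure_biUnion_le _ hu _)
    _ = 5 * ∑' t : u, ENNReal.ofReal a * ENNReal.ofReal (2 * r t) := by
        rw [← ENNReal.tsum_mul_left, ← ENNReal.tsum_mul_left]
        refine tsum_congr fun t ↦ ?_
        rw [Real.volume_closedBall, show 2 * (5 * r t) = 5 * (2 * r t) by ring,
          ENNReal.ofReal_mul (by norm_num : (0 : ℝ) ≤ 5), ENNReal.ofReal_ofNat]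
        ring
    _ ≤ 5 * ∑' t : u, ν (closedBall (t : ℝ) (r t)) := by
        gcongr with t
        exact hball t (huB t.2)
    _ = 5 * ν (⋃ t ∈ u, closedBall t (r t)) := by
        exact congrArg (5 * ·)
          (measure_biUnion hu hdisj fun _ _ ↦ isClosed_closedBall.measurableSet).symm
    _ ≤ 5 * ν univ := by gcongr; exact subset_univ _

theorem maximalFn_eq_iSup_rat (ν : Measure ℝ) (t : ℝ) :
    maximalFn ν t =
      ⨆ (q : ℚ) (_ : 0 < q), ν (Ioo (t - q) (t + q)) / ENNReal.ofReal (2 * q) := by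
  refine le_antisymm (le_of_forall_lt fun c hc ↦ ?_)
    (iSup₂_le fun q hq ↦ le_iSup₂_of_le (q : ℝ) (by exact_mod_cast hq) le_rfl)
  obtain ⟨r, hr, h⟩ := exists_radius_of_lt_maximalFn hc
  have hunion : Ioo (t - r) (t + r) = ⋃ q : {q : ℚ // (q : ℝ) < r}, Ioo (t - q.1) (t + q.1) := by
    ext s
    simp only [mem_Ioo, mem_iUnion, Subtype.exists, exists_prop]
    constructor
    · rintro ⟨h₁, h₂⟩
      obtain ⟨q, hq, hqr⟩ := exists_rat_btwn (max_lt (sub_lt_comm.1 h₁) (sub_lt_iff_lt_add'.2 h₂))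
      have := max_lt_iff.1 hq
      exact ⟨q, hqr, by linarith, by linarith⟩
    · rintro ⟨q, hqr, h₁, h₂⟩
      exact ⟨by linarith, by linarith⟩
  have hmono : Monotone fun q : {q : ℚ // (q : ℝ) < r} ↦ Ioo (t - q.1 : ℝ) (t + q.1) :=
    fun p q hpq ↦ by
      have : (p.1 : ℝ) ≤ q.1 := by exact_mod_cast hpq
      exact Ioo_subset_Ioo (by linarith) (by linarith)
  rw [hunion, hmono.measure_iUnion, lt_iSup_iff] at h
  obtain ⟨⟨q, hqr⟩, h⟩ := h
  have hq : (0 : ℝ) < q := by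
    by_contra! hq
    rw [Ioo_eq_empty (by dsimp only; linarith), measure_empty] at h
    exact not_lt_zero h
  simp only [lt_iSup_iff]
  refine ⟨q, by exact_mod_cast hq, (ENNReal.lt_div_iff_mul_lt (Or.inl (by simpa using hq))
    (Or.inl ENNReal.ofReal_ne_top)).2 (lt_of_le_of_lt ?_ h)⟩
  gcongr

theorem continuous_uncurry_proj : Continuous fun p : ℝ × R2 ↦ proj p.1 p.2 := by
  unfold proj
  fun_prop

theorem continuous_proj (θ : ℝ) : Continuous (proj θ) :=
  continuous_uncurry_proj.comp (Continuous.prodMk_right θ)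

theorem lipschitzWith_proj (θ : ℝ) : LipschitzWith 1 (proj θ) := by
  refine LipschitzWith.of_dist_le_mul fun x y ↦ ?_
  rw [EuclideanSpace.dist_eq, Real.dist_eq, NNReal.coe_one, one_mul]
  refine Real.abs_le_sqrt ?_
  simp only [Fin.sum_univ_two, Real.dist_eq, sq_abs, proj]
  set c := Real.cos (2 * Real.pi * θ)
  set s := Real.sin (2 * Real.pi * θ)
  have h : s ^ 2 + c ^ 2 = 1 := Real.sin_sq_add_cos_sq _
  calc (x 0 * c + x 1 * s - (y 0 * c + y 1 * s)) ^ 2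
      = ((x 0 - y 0) ^ 2 + (x 1 - y 1) ^ 2) * (s ^ 2 + c ^ 2)
          - ((x 0 - y 0) * s - (x 1 - y 1) * c) ^ 2 := by ring
    _ ≤ _ := by rw [h, mul_one]; exact sub_le_self _ (sq_nonneg _)

theorem measurable_uncurry_projMax (μ : Measure R2) [SFinite μ] :
    Measurable fun p : ℝ × R2 ↦ projMax μ p.1 p.2 := by
  simp only [projMax, maximalFn_eq_iSup_rat]
  refine Measurable.iSup fun q ↦ Measurable.iSup fun _ ↦ Measurable.div_const ?_ _
  have hopen : IsOpen {z : (ℝ × R2) × R2 |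
      proj z.1.1 z.2 ∈ Ioo (proj z.1.1 z.1.2 - q) (proj z.1.1 z.1.2 + q)} := by
    have h₁ : Continuous fun z : (ℝ × R2) × R2 ↦ proj z.1.1 z.2 :=
      continuous_uncurry_proj.comp (by fun_prop : Continuous fun z : (ℝ × R2) × R2 ↦ (z.1.1, z.2))
    have h₂ : Continuous fun z : (ℝ × R2) × R2 ↦ proj z.1.1 z.1.2 :=
      continuous_uncurry_proj.comp continuous_fst
    exact (isOpen_lt (h₂.sub continuous_const) h₁).inter (isOpen_lt h₁ (h₂.add continuous_const))
  convert measurable_measure_prodMk_left (ν := μ) hopen.measurableSet using 2 with p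
  exact Measure.map_apply (continuous_proj p.1).measurable measurableSet_Ioo

/-- If `π_θ(E)` is large, then `μ_θ` is bounded on a large part of `E`. -/
theorem half_mul_le_measure_projMax_le {E : Set R2} (hfin : μH[1] E < ⊤)
    {κ θ : ℝ} (hκ : 0 < κ) (hθ : ENNReal.ofReal κ * μH[1] E < μH[1] (proj θ '' E)) :
    ENNReal.ofReal (κ / 2) * μH[1] E ≤ μH[1].restrict E
      {x | projMax (μH[1].restrict E) θ x ≤ ENNReal.ofReal (10 * κ⁻¹)} := by
  set μ : Measure R2 := μH[1].restrict E
  set F := {x | projMax μ θ x ≤ ENNReal.ofReal (10 * κ⁻¹)}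
  have : IsFiniteMeasure μ := ⟨by simpa [μ] using hfin⟩
  set B := {t | ENNReal.ofReal (10 * κ⁻¹) < maximalFn (μ.map (proj θ)) t}
  have hsub : proj θ '' E ⊆ proj θ '' (F ∩ E) ∪ B := by
    rintro _ ⟨x, hx, rfl⟩
    by_cases h : x ∈ F
    · exact Or.inl ⟨x, ⟨h, hx⟩, rfl⟩
    · right
      rw [mem_ofPred_eq, not_le] at h
      exact h
  have hB : volume B ≤ ENNReal.ofReal (κ / 2) * μH[1] E := by
    have h := mul_volume_lt_maximalFn_le (μ.map (proj θ)) (a := 10 * κ⁻¹) (by positivity)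
    rw [Measure.map_apply (continuous_proj θ).measurable .univ, preimage_univ,
      Measure.restrict_apply_univ] at h
    calc volume B = ENNReal.ofReal (κ / 10) * (ENNReal.ofReal (10 * κ⁻¹) * volume B) := by
          rw [← mul_assoc, ← ENNReal.ofReal_mul (by positivity),
            show κ / 10 * (10 * κ⁻¹) = 1 by field_simp, ENNReal.ofReal_one, one_mul]
      _ ≤ ENNReal.ofReal (κ / 10) * (5 * μH[1] E) := by gcongr
      _ = ENNReal.ofReal (κ / 2) * μH[1] E := by
          rw [← mul_assoc, ← ENNReal.ofReal_ofNat 5, ← ENNReal.ofReal_mul (by positivity)]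
          congr 2
          ring
  have hF : μH[1] (proj θ '' (F ∩ E)) ≤ μ F := by
    refine ((lipschitzWith_proj θ).hausdorffMeasure_image_le zero_le_one _).trans ?_
    rw [ENNReal.coe_one, ENNReal.one_rpow, one_mul]
    exact Measure.le_restrict_apply E F
  refine (ENNReal.add_le_add_iff_right
    (ENNReal.mul_ne_top ENNReal.ofReal_ne_top hfin.ne : ENNReal.ofReal (κ / 2) * μH[1] E ≠ ⊤)).1 ?_
  calc ENNReal.ofReal (κ / 2) * μH[1] E + ENNReal.ofReal (κ / 2) * μH[1] E
      = ENNReal.ofReal κ * μH[1] E := by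
        rw [← add_mul, ← ENNReal.ofReal_add (by positivity) (by positivity), add_halves]
    _ ≤ μH[1] (proj θ '' E) := hθ.le
    _ ≤ μH[1] (proj θ '' (F ∩ E)) + μH[1] B := (measure_mono hsub).trans (measure_union_le _ _)
    _ ≤ μ F + ENNReal.ofReal (κ / 2) * μH[1] E := by
        rw [hausdorffMeasure_real] at hF ⊢
        exact add_le_add hF hB

/-- If every section of `S` over `α` has measure at least `2c`, then many sections over `β`
have measure at least a proportional amount. -/
theorem le_measure_section_of_le_section {α β : Type*} [MeasurableSpace α] [MeasurableSpace β]
    (ν : Measure α) (μ : Measure β) [IsFiniteMeasure ν] [IsFiniteMeasure μ]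
    (hν : ν univ ≠ 0) {S : Set (α × β)} (hS : MeasurableSet S) {c : ℝ≥0∞} (hc : c ≠ ⊤)
    (h : ∀ᵐ a ∂ν, 2 * (c * μ univ) ≤ μ (Prod.mk a ⁻¹' S)) :
    c * μ univ ≤ μ {b | c * ν univ ≤ ν ((fun a ↦ (a, b)) ⁻¹' S)} := by
  set T := {b | c * ν univ ≤ ν ((fun a ↦ (a, b)) ⁻¹' S)}
  have hT : MeasurableSet T := measurableSet_le measurable_const (measurable_measure_prodMk_right hS)
  have hle : ν univ * (2 * (c * μ univ)) ≤ ν univ * (c * μ univ + μ T) :=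
    calc ν univ * (2 * (c * μ univ)) = ∫⁻ _, 2 * (c * μ univ) ∂ν := by
          rw [lintegral_const, mul_comm]
      _ ≤ ∫⁻ a, μ (Prod.mk a ⁻¹' S) ∂ν := lintegral_mono_ae h
      _ = ∫⁻ b, ν ((fun a ↦ (a, b)) ⁻¹' S) ∂μ := by
          rw [← Measure.prod_apply hS, Measure.prod_apply_symm hS]
      _ ≤ ∫⁻ b, c * ν univ + T.indicator (fun _ ↦ ν univ) b ∂μ := by
          refine lintegral_mono fun b ↦ ?_
          by_cases hb : b ∈ T
          · rw [indicator_of_mem hb]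
            exact (measure_mono (subset_univ _)).trans le_add_self
          · exact (not_le.1 hb).le.trans le_self_add
      _ = ν univ * (c * μ univ + μ T) := by
          rw [lintegral_add_left measurable_const, lintegral_const, lintegral_indicator_const hT]
          ring
  rw [ENNReal.mul_le_mul_iff_right hν (measure_ne_top ν univ), two_mul] at hle
  exact (ENNReal.add_le_add_iff_left (ENNReal.mul_ne_top hc (measure_ne_top μ univ))).1 hle

/-- many directions with bounded maximal function, for many points. -/
theorem statement4 :
    ∃ C : ℝ, 1 ≤ C ∧
      ∀ (κ : ℝ) (G : Set ℝ) (E : Set R2), 0 < κ →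
        MeasurableSet G → G ⊆ Set.Ico (0:ℝ) 1 → 0 < μH[1] G →
        MeasurableSet E → μH[1] E < ⊤ →
        (∀ θ ∈ G, ENNReal.ofReal κ * μH[1] E < μH[1] (proj θ '' E)) →
        ENNReal.ofReal (κ/4) * μH[1] E ≤
          μH[1] {x ∈ E |
            ENNReal.ofReal (κ/4) * μH[1] G ≤
              μH[1] {θ ∈ G | projMax (μH[1].restrict E) θ x ≤ ENNReal.ofReal (C * κ⁻¹)}} := by
  refine ⟨10, by norm_num, fun κ G E hκ hG hG1 hG0 hE hfin hproj ↦ ?_⟩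
  rw [hausdorffMeasure_real] at hG0 ⊢
  set μ : Measure R2 := μH[1].restrict E
  have : IsFiniteMeasure μ := ⟨by simpa [μ] using hfin⟩
  have : IsFiniteMeasure (volume.restrict G) := ⟨by
    rw [Measure.restrict_apply_univ]
    exact (measure_mono hG1).trans_lt measure_Ico_lt_top⟩
  set S := {p : ℝ × R2 | projMax μ p.1 p.2 ≤ ENNReal.ofReal (10 * κ⁻¹)}
  have hS : MeasurableSet S := measurableSet_le (measurable_uncurry_projMax μ) measurable_const
  have key := le_measure_section_of_le_section (volume.restrict G) μ
    (by rw [Measure.restrict_apply_univ]; exact hG0.ne') hS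
    (c := ENNReal.ofReal (κ / 4)) ENNReal.ofReal_ne_top (by
      filter_upwards [ae_restrict_mem hG] with θ hθ
      refine le_trans (le_of_eq ?_) (half_mul_le_measure_projMax_le hfin hκ (hproj θ hθ))
      rw [Measure.restrict_apply_univ, ← mul_assoc, two_mul,
        ← ENNReal.ofReal_add (by positivity) (by positivity)]
      congr 2
      ring)
  simp only [Measure.restrict_apply_univ, μ] at key
  rw [Measure.restrict_apply' hE] at key
  refine key.trans (measure_mono fun x hx ↦ ⟨hx.2, hx.1.trans ?_⟩)
  rw [Measure.restrict_apply' hG]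
  exact measure_mono fun θ h ↦ ⟨h.2, h.1⟩

end
end

section
/- For every α > 1 there exists a constant C = C(α) > 4 such that: if x, y ∈ ℝ², I ⊂ 𝕋 is an interval, and R > r > C·d_I(x,y), then X(x,I,r,R) ⊂ X(y,αI,r/2,2R). -/
open MeasureTheory Metric Set
open scoped ENNReal NNReal

noncomputable section

theorem abs_arctan_le_abs (u : ℝ) : |Real.arctan u| ≤ |u| := by
  have key : ∀ v : ℝ, 0 ≤ v → Real.arctan v ≤ v := fun v hv => by
    have h := Real.le_tan (Real.arctan_nonneg.2 hv) (Real.arctan_lt_pi_div_two v)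
    rwa [Real.tan_arctan] at h
  rcases le_total 0 u with hu | hu
  · rw [abs_of_nonneg hu, abs_of_nonneg (Real.arctan_nonneg.2 hu)]
    exact key u hu
  · have h := key (-u) (neg_nonneg.2 hu)
    rw [Real.arctan_neg] at h
    rw [abs_of_nonpos hu, abs_of_nonpos (by simpa using hu)]
    exact h

theorem dmet_nonneg (c ℓ : ℝ) (x y : R2) : 0 ≤ dmet c ℓ x y := Real.sqrt_nonneg _

theorem dmet_sq (c ℓ : ℝ) (x y : R2) :
    dmet c ℓ x y ^ 2 =
      (ℓ^2)⁻¹ * (projPerp c x - projPerp c y)^2 + (proj c x - proj c y)^2 :=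
  Real.sq_sqrt (by positivity)

theorem abs_proj_sub_le_dmet (c ℓ : ℝ) (x y : R2) :
    |proj c x - proj c y| ≤ dmet c ℓ x y := by
  refine abs_le_of_sq_le_sq ?_ (dmet_nonneg c ℓ x y)
  rw [dmet_sq]
  have : 0 ≤ (ℓ^2)⁻¹ * (projPerp c x - projPerp c y)^2 := by positivity
  linarith

theorem abs_projPerp_sub_le_dmet (c : ℝ) {ℓ : ℝ} (hℓ : 0 < ℓ) (x y : R2) :
    |projPerp c x - projPerp c y| ≤ ℓ * dmet c ℓ x y := by
  refine abs_le_of_sq_le_sq ?_ (mul_nonneg hℓ.le (dmet_nonneg c ℓ x y))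
  rw [mul_pow, dmet_sq, mul_add, mul_inv_cancel_left₀ (by positivity)]
  have : 0 ≤ ℓ^2 * (proj c x - proj c y)^2 := by positivity
  linarith

theorem proj_sub (c : ℝ) (x y : R2) : proj c x - proj c y = proj c (x - y) := by
  simp only [proj, PiLp.sub_apply]; ring

theorem projPerp_sub (c : ℝ) (x y : R2) : projPerp c x - projPerp c y = projPerp c (x - y) :=
  proj_sub _ x y

theorem projPerp_eq (c : ℝ) (x : R2) :
    projPerp c x = x 1 * Real.cos (2 * Real.pi * c) - x 0 * Real.sin (2 * Real.pi * c) := by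
  have h : 2 * Real.pi * (c + 1/4) = 2 * Real.pi * c + Real.pi / 2 := by ring
  rw [projPerp, proj, h, Real.cos_add_pi_div_two, Real.sin_add_pi_div_two]
  ring

theorem proj_sq_add_projPerp_sq (c : ℝ) (x : R2) :
    proj c x ^ 2 + projPerp c x ^ 2 = ‖x‖ ^ 2 := by
  rw [EuclideanSpace.real_norm_sq_eq, Fin.sum_univ_two, projPerp_eq, proj]
  linear_combination (x 0 ^ 2 + x 1 ^ 2) * Real.sin_sq_add_cos_sq (2 * Real.pi * c)

theorem abs_proj_le_norm (c : ℝ) (x : R2) : |proj c x| ≤ ‖x‖ := by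
  refine abs_le_of_sq_le_sq ?_ (norm_nonneg x)
  rw [← proj_sq_add_projPerp_sq c]
  linarith [sq_nonneg (projPerp c x)]

theorem norm_sub_le_dmet (c : ℝ) {ℓ : ℝ} (hℓ : 0 < ℓ) (hℓ1 : ℓ ≤ 1) (x y : R2) :
    ‖x - y‖ ≤ dmet c ℓ x y := by
  refine (sq_le_sq₀ (norm_nonneg _) (dmet_nonneg c ℓ x y)).1 ?_
  rw [← proj_sq_add_projPerp_sq c, dmet_sq, ← proj_sub, ← projPerp_sub]
  have h : 1 ≤ (ℓ^2)⁻¹ := (one_le_inv₀ (by positivity)).2 (pow_le_one₀ hℓ.le hℓ1)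
  nlinarith [sq_nonneg (projPerp c x - projPerp c y)]

theorem dir_zero (θ : ℝ) : dir θ 0 = Real.cos (2 * Real.pi * θ) := by simp [dir]

theorem dir_one (θ : ℝ) : dir θ 1 = Real.sin (2 * Real.pi * θ) := by simp [dir]

theorem norm_dir (θ : ℝ) : ‖dir θ‖ = 1 := by
  have h : ‖dir θ‖ ^ 2 = 1 := by
    rw [EuclideanSpace.real_norm_sq_eq, Fin.sum_univ_two, dir_zero, dir_one]
    exact Real.cos_sq_add_sin_sq _
  exact (pow_eq_one_iff_of_nonneg (norm_nonneg _) two_ne_zero).1 h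

theorem proj_smul_dir_add (θ t : ℝ) (w : R2) : proj θ (t • dir θ + w) = t + proj θ w := by
  simp only [proj, PiLp.add_apply, PiLp.smul_apply, smul_eq_mul, dir_zero, dir_one]
  linear_combination t * Real.cos_sq_add_sin_sq (2 * Real.pi * θ)

theorem projPerp_smul_dir_add (θ t : ℝ) (w : R2) :
    projPerp θ (t • dir θ + w) = projPerp θ w := by
  simp only [projPerp_eq, PiLp.add_apply, PiLp.smul_apply, smul_eq_mul, dir_zero, dir_one]
  ring

theorem projPerp_add (c h : ℝ) (w : R2) :
    projPerp (c + h) w =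
      projPerp c w * Real.cos (2 * Real.pi * h) - proj c w * Real.sin (2 * Real.pi * h) := by
  simp only [projPerp_eq, proj, mul_add, Real.cos_add, Real.sin_add]
  ring

/-- A vector with nonzero component along `dir θ` lies on a line whose direction differs from `θ`
by at most the normalized slope. -/
theorem exists_eq_smul_dir (θ : ℝ) (v : R2) (hv : proj θ v ≠ 0) :
    ∃ δ s : ℝ, v = s • dir (θ + δ) ∧
      2 * Real.pi * |δ| ≤ |projPerp θ v| / |proj θ v| := by
  set u := projPerp θ v / proj θ v with hu
  have hπ : (0:ℝ) < 2 * Real.pi := by positivity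
  have hs : √(1 + u ^ 2) ≠ 0 := by positivity
  have hua : proj θ v * u = projPerp θ v := by rw [hu]; field_simp
  have hδ : 2 * Real.pi * (θ + Real.arctan u / (2 * Real.pi)) =
      2 * Real.pi * θ + Real.arctan u := by field_simp
  refine ⟨Real.arctan u / (2 * Real.pi), proj θ v * √(1 + u ^ 2), ?_, ?_⟩
  · have h1 := Real.cos_sq_add_sin_sq (2 * Real.pi * θ)
    ext i
    fin_cases i
    · have : proj θ v * √(1 + u ^ 2) * dir (θ + Real.arctan u / (2 * Real.pi)) 0 =
          proj θ v * Real.cos (2 * Real.pi * θ) - projPerp θ v * Real.sin (2 * Real.pi * θ) := by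
        rw [dir_zero, hδ, Real.cos_add, Real.cos_arctan, Real.sin_arctan, ← hua]
        field_simp
      simp only [Fin.zero_eta, PiLp.smul_apply, smul_eq_mul]
      rw [this, projPerp_eq, proj]
      linear_combination -(v 0) * h1
    · have : proj θ v * √(1 + u ^ 2) * dir (θ + Real.arctan u / (2 * Real.pi)) 1 =
          proj θ v * Real.sin (2 * Real.pi * θ) + projPerp θ v * Real.cos (2 * Real.pi * θ) := by
        rw [dir_one, hδ, Real.sin_add, Real.cos_arctan, Real.sin_arctan, ← hua]
        field_simp
      simp only [Fin.mk_one, PiLp.smul_apply, smul_eq_mul]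
      rw [this, projPerp_eq, proj]
      linear_combination -(v 1) * h1
  · rw [abs_div, abs_of_pos hπ, mul_div_cancel₀ _ hπ.ne', ← abs_div]
    exact abs_arctan_le_abs u

theorem abs_projPerp_sub_le_of_mem_itv {c ℓ θ : ℝ} (hℓ : 0 < ℓ) (hθ : θ ∈ itv c ℓ) (x y : R2) :
    |projPerp θ (x - y)| ≤ (1 + Real.pi) * ℓ * dmet c ℓ x y := by
  obtain ⟨h1, h2⟩ := hθ
  have hd := dmet_nonneg c ℓ x y
  have hp := abs_proj_sub_le_dmet c ℓ x y
  have hq := abs_projPerp_sub_le_dmet c hℓ x y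
  rw [proj_sub] at hp
  rw [projPerp_sub] at hq
  have hsin : |Real.sin (2 * Real.pi * (θ - c))| ≤ Real.pi * ℓ := by
    refine Real.abs_sin_le_abs.trans ?_
    rw [abs_mul, abs_of_pos (by positivity : (0:ℝ) < 2 * Real.pi)]
    have : |θ - c| ≤ ℓ / 2 := abs_le.2 ⟨by linarith, by linarith⟩
    nlinarith [Real.pi_pos]
  have hcos := Real.abs_cos_le_one (2 * Real.pi * (θ - c))
  have hadd := projPerp_add c (θ - c) (x - y)
  rw [add_sub_cancel] at hadd
  rw [hadd]
  refine (abs_sub _ _).trans ?_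
  rw [abs_mul, abs_mul]
  have e1 := mul_le_mul hq hcos (abs_nonneg _) (by positivity)
  have e2 := mul_le_mul hp hsin (abs_nonneg _) hd
  linarith

/-- double-truncated cones at nearby points are nested. -/
theorem statement8 (α : ℝ) (hα : 1 < α) :
    ∃ C : ℝ, 4 < C ∧
      ∀ (x y : R2) (c ℓ r R : ℝ), 0 < ℓ → ℓ ≤ 1 →
        C * dmet c ℓ x y < r → r < R →
        coneA x (itv c ℓ) r R ⊆ coneA y (itv c (α * ℓ)) (r/2) (2*R) := by
  have hα' : 0 < α - 1 := by linarith
  have hC : 0 < 2 / (α - 1) := by positivity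
  refine ⟨5 + 2 / (α - 1), by linarith, ?_⟩
  rintro x y c ℓ r R hℓ hℓ1 hr hrR z ⟨⟨hz, hzR⟩, hzr⟩
  rw [mem_ball, dist_eq_norm] at hzR hzr
  rw [not_lt] at hzr
  have hd := dmet_nonneg c ℓ x y
  have hxy := norm_sub_le_dmet c hℓ hℓ1 x y
  have hdr : 5 * dmet c ℓ x y + 2 / (α - 1) * dmet c ℓ x y < r := by linarith
  have hCd : 0 ≤ 2 / (α - 1) * dmet c ℓ x y := by positivity
  have hzy : z - y = (z - x) + (x - y) := by abel
  refine ⟨⟨?_, ?_⟩, ?_⟩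
  · simp only [cone, mem_iUnion, mem_ofPred_eq, exists_prop] at hz ⊢
    obtain ⟨θ, hθ, t, rfl⟩ := hz
    rw [add_sub_cancel_left] at hzy
    rw [add_sub_cancel_left, norm_smul, norm_dir, mul_one, Real.norm_eq_abs] at hzr
    have hb := abs_projPerp_sub_le_of_mem_itv hℓ hθ x y
    have ha : r - dmet c ℓ x y ≤ |t + proj θ (x - y)| := by
      have h1 := abs_sub_abs_le_abs_sub t (-proj θ (x - y))
      rw [abs_neg, sub_neg_eq_add] at h1
      linarith [abs_proj_le_norm θ (x - y)]
    have ha0 : 0 < |t + proj θ (x - y)| := by linarith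
    obtain ⟨δ, s, hv, hδ⟩ := exists_eq_smul_dir θ (t • dir θ + (x - y))
      (by rw [proj_smul_dir_add]; exact abs_pos.1 ha0)
    rw [proj_smul_dir_add, projPerp_smul_dir_add, le_div_iff₀ ha0] at hδ
    have hδ' : |δ| ≤ (α - 1) * ℓ / 2 := by
      have h1 : 2 / (α - 1) * dmet c ℓ x y ≤ |t + proj θ (x - y)| := by linarith
      have h2 : 2 * dmet c ℓ x y ≤ (α - 1) * |t + proj θ (x - y)| := by
        have := mul_le_mul_of_nonneg_left h1 hα'.le
        rwa [← mul_assoc, mul_div_cancel₀ _ hα'.ne'] at this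
      have h3 : (1 + Real.pi) * ℓ * dmet c ℓ x y ≤ 2 * Real.pi * ℓ * dmet c ℓ x y := by
        gcongr
        linarith [Real.pi_gt_three]
      have h4 : 2 * Real.pi * ℓ * dmet c ℓ x y ≤
          Real.pi * ℓ * ((α - 1) * |t + proj θ (x - y)|) := by
        have := mul_le_mul_of_nonneg_left h2 (by positivity : 0 ≤ Real.pi * ℓ)
        linarith
      have h5 : (2 * Real.pi * |t + proj θ (x - y)|) * |δ| ≤
          (2 * Real.pi * |t + proj θ (x - y)|) * ((α - 1) * ℓ / 2) := by linarith
      exact le_of_mul_le_mul_left h5 (by positivity)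
    obtain ⟨h1, h2⟩ := hθ
    obtain ⟨h3, h4⟩ := abs_le.1 hδ'
    refine ⟨θ + δ, ⟨by linarith, by linarith⟩, s, ?_⟩
    rw [← hv, ← hzy, add_sub_cancel]
  · rw [mem_ball, dist_eq_norm, hzy]
    linarith [norm_add_le (z - x) (x - y)]
  · rw [mem_ball, dist_eq_norm, hzy, not_lt]
    have h := norm_sub_le (z - x + (x - y)) (x - y)
    rw [add_sub_cancel_right] at h
    linarith

end
end
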